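/- There exist constants C₃ > 0 and α̃ > 1, depending only on f and φ, such that for every α > α̃, ‖ π_α(φ) ‖⁴ ≤ C₃ · m_α. -/

import Mathlib

open MeasureTheory ProbabilityTheory Real

noncomputable section

/-- `ℝ^d` as a Euclidean space. -/
abbrev E (d : ℕ) := EuclideanSpace ℝ (Fin d)

/-- The `i`-th standard basis vector of `ℝ^d`. -/
def bvec (d : ℕ) (i : Fin d) : E d := EuclideanSpace.single i 1

/-- The normalizing constant `Z_α := ∫ exp (-α f)`. -/
def Zc {d : ℕ} (f : E d → ℝ) (α : ℝ) : ℝ := ∫ x, Real.exp (-α * f x)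

/-- The Hessian matrix of `f` at `x`, via the second iterated derivative. -/
def hess {d : ℕ} (f : E d → ℝ) (x : E d) : Matrix (Fin d) (Fin d) ℝ :=
  Matrix.of fun i j => iteratedFDeriv ℝ 2 f x ![bvec d i, bvec d j]

/-- `m_α := √(det H_f(x⋆)) · (α/(2π))^{d/2}`. -/
def mconst {d : ℕ} (f : E d → ℝ) (xs : E d) (α : ℝ) : ℝ :=
  Real.sqrt (hess f xs).det * (α / (2 * π)) ^ ((d : ℝ) / 2)

/-- The partial trace of `D³ f` at `x`: `PTr(D³f(x))_i = ∑_k ∂_i∂_k∂_k f(x)`. -/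
def ptr3 {d : ℕ} (f : E d → ℝ) (x : E d) (i : Fin d) : ℝ :=
  ∑ k, iteratedFDeriv ℝ 3 f x ![bvec d i, bvec d k, bvec d k]

/-- The Laplace constant `C_{f,φ}` for a vector-valued test function `φ : ℝ^d → ℝ^q`. -/
def CL {d q : ℕ} (f : E d → ℝ) (x : E d) (φ : E d → E q) : ℝ :=
  ∑ i : Fin q,
    |(∑ j : Fin d, iteratedFDeriv ℝ 2 (fun y => φ y i) x ![bvec d j, bvec d j]) -
      ∑ j : Fin d, fderiv ℝ (fun y => φ y i) x (bvec d j) * ptr3 f x j|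

/-- The Laplace constant `C_{f,ψ}` for a scalar test function `ψ : ℝ^d → ℝ`. -/
def CLs {d : ℕ} (f : E d → ℝ) (x : E d) (ψ : E d → ℝ) : ℝ :=
  |(∑ j : Fin d, iteratedFDeriv ℝ 2 ψ x ![bvec d j, bvec d j]) -
    ∑ j : Fin d, fderiv ℝ ψ x (bvec d j) * ptr3 f x j|

/-- `π_α(φ) := ∫ φ dπ_α`, the mean of `φ` under the Gibbs measure `π_α ∝ exp(-α f)`. -/
def piInt {d q : ℕ} (f : E d → ℝ) (α : ℝ) (φ : E d → E q) : E q :=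
  ∫ x, (Real.exp (-α * f x) / Zc f α) • φ x

theorem quad_bound {d : ℕ} (f : E d → ℝ) (xs : E d) (hf : ContDiff ℝ 4 f)
    (hmin : ∀ x, f xs ≤ f x) :
    ∃ K : ℝ, 0 ≤ K ∧ ∃ r > 0, ∀ x, ‖x - xs‖ < r → f x - f xs ≤ K * ‖x - xs‖ ^ 2 := by
  have h0 : fderiv ℝ f xs = 0 :=
    IsLocalMin.fderiv_eq_zero (Filter.Eventually.of_forall hmin)
  have h1 : ContDiff ℝ 1 (fderiv ℝ f) := hf.fderiv_right (by norm_num)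
  obtain ⟨K, t, ht, hK⟩ := h1.contDiffAt.exists_lipschitzOnWith (x := xs)
  obtain ⟨r, hr, hrt⟩ := Metric.mem_nhds_iff.1 ht
  refine ⟨K, K.2, r, hr, fun x hx => ?_⟩
  have hsub : Metric.closedBall xs ‖x - xs‖ ⊆ t := fun y hy =>
    hrt (by rw [Metric.mem_closedBall] at hy; exact lt_of_le_of_lt hy hx)
  have hb : ∀ y ∈ Metric.closedBall xs ‖x - xs‖, ‖fderiv ℝ f y‖ ≤ K * ‖x - xs‖ := by
    intro y hy
    have := hK.dist_le_mul y (hsub hy) xs (mem_of_mem_nhds ht)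
    rw [h0, dist_zero_right] at this
    refine this.trans ?_
    have h2 := Metric.mem_closedBall.1 hy
    gcongr
  have := (convex_closedBall xs ‖x - xs‖).norm_image_sub_le_of_norm_fderiv_le
    (fun y _ => (hf.differentiable (by norm_num)) y) hb
    (Metric.mem_closedBall_self (norm_nonneg _))
    (by rw [Metric.mem_closedBall, dist_eq_norm] : x ∈ Metric.closedBall xs ‖x - xs‖)
  calc f x - f xs ≤ ‖f x - f xs‖ := le_abs_self _
    _ ≤ _ := this
    _ = _ := by ring

theorem jensen4 {d q : ℕ} (w : E d → ℝ) (hw : ∀ x, 0 ≤ w x) (hwi : Integrable w)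
    (hw1 : ∫ x, w x = 1) (φ : E d → E q) (hφ : Measurable φ)
    (h4 : Integrable fun x => w x * ‖φ x‖ ^ 4) :
    ‖∫ x, w x • φ x‖ ^ 4 ≤ ∫ x, w x * ‖φ x‖ ^ 4 := by
  have h1 : Integrable fun x => w x * ‖φ x‖ := by
    refine (hwi.add h4).mono' (hwi.aestronglyMeasurable.mul hφ.norm.aestronglyMeasurable) ?_
    refine Filter.Eventually.of_forall fun x => ?_
    have ht : ‖φ x‖ ≤ 1 + ‖φ x‖ ^ 4 := by
      nlinarith [sq_nonneg (‖φ x‖ ^ 2 - 1/2), sq_nonneg (‖φ x‖ - 1/2)]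
    rw [Real.norm_of_nonneg (mul_nonneg (hw x) (norm_nonneg _))]
    have := mul_le_mul_of_nonneg_left ht (hw x)
    simp only [Pi.add_apply]
    linarith
  set s := ∫ x, w x * ‖φ x‖ with hs
  have hs0 : 0 ≤ s := integral_nonneg fun x => mul_nonneg (hw x) (norm_nonneg _)
  have hn : ‖∫ x, w x • φ x‖ ≤ s := by
    refine (norm_integral_le_integral_norm _).trans (le_of_eq ?_)
    refine integral_congr_ae (Filter.Eventually.of_forall fun x => ?_)
    simp only [norm_smul, Real.norm_of_nonneg (hw x)]
  refine (pow_le_pow_left₀ (norm_nonneg _) hn 4).trans ?_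
  have key : ∫ x, (4 * s ^ 3 * (w x * ‖φ x‖) - 3 * s ^ 4 * w x) ≤ ∫ x, w x * ‖φ x‖ ^ 4 := by
    refine integral_mono ((h1.const_mul _).sub (hwi.const_mul _)) h4 fun x => ?_
    have ht : 4 * s ^ 3 * ‖φ x‖ - 3 * s ^ 4 ≤ ‖φ x‖ ^ 4 := by
      have : 0 ≤ (‖φ x‖ - s) ^ 2 * ((‖φ x‖ + s) ^ 2 + 2 * s ^ 2) := by positivity
      nlinarith
    have := mul_le_mul_of_nonneg_left ht (hw x)
    simp only
    linarith
  rw [integral_sub (h1.const_mul _) (hwi.const_mul _), integral_const_mul, integral_const_mul,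
    hw1, ← hs] at key
  linarith

theorem Z_lower {d : ℕ} (f : E d → ℝ) (xs : E d) (K r : ℝ) (hK : 0 ≤ K)
    (hb : ∀ x, ‖x - xs‖ < r → f x - f xs ≤ K * ‖x - xs‖ ^ 2)
    (α s : ℝ) (hα : 0 < α) (hs : 0 < s) (hsr : s < r) (hsα : α * s ^ 2 = 1)
    (hi : Integrable fun x => Real.exp (-(α * (f x - f xs)))) :
    Real.exp (-K) * (s ^ d * volume.real (Metric.ball (0 : E d) 1)) ≤
      ∫ x, Real.exp (-(α * (f x - f xs))) := by
  have hv : volume.real (Metric.ball xs s) = s ^ d * volume.real (Metric.ball (0 : E d) 1) := by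
    rw [Measure.real, Measure.addHaar_ball_of_pos _ _ hs, ENNReal.toReal_mul,
      ENNReal.toReal_ofReal (by positivity), finrank_euclideanSpace_fin, Measure.real]
  rw [← hv]
  calc Real.exp (-K) * volume.real (Metric.ball xs s)
      = ∫ x in Metric.ball xs s, Real.exp (-K) := by
        rw [setIntegral_const, smul_eq_mul, mul_comm]
    _ ≤ ∫ x in Metric.ball xs s, Real.exp (-(α * (f x - f xs))) := by
        refine setIntegral_mono_on (integrableOn_const measure_ball_lt_top.ne) hi.integrableOn
          measurableSet_ball fun x hx => ?_
        rw [Metric.mem_ball, dist_eq_norm] at hx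
        apply Real.exp_le_exp.2
        have h1 := hb x (hx.trans hsr)
        have h2 : ‖x - xs‖ ^ 2 ≤ s ^ 2 := by gcongr
        have : α * (f x - f xs) ≤ α * (K * s ^ 2) := by
          gcongr
          exact h1.trans (by gcongr)
        have e : α * (K * s ^ 2) = K := by
          calc _ = K * (α * s ^ 2) := by ring
            _ = K := by rw [hsα, mul_one]
        linarith
    _ ≤ _ := setIntegral_le_integral hi (Filter.Eventually.of_forall fun x => (Real.exp_pos _).le)

/-- fourth-power bound on `π_α(φ)`. -/
theorem stmt10 {d q : ℕ} (hd : 1 ≤ d) (hq : 1 ≤ q)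
    (f : E d → ℝ) (xs : E d)
    (hf : ContDiff ℝ 4 f)
    (hmin : ∀ x, x ≠ xs → f xs < f x)
    (hpd : (hess f xs).PosDef)
    (hfint : Integrable fun x => Real.exp (-f x))
    (φ : E d → E q) (hφmeas : Measurable φ)
    (hφ4exp : Integrable fun y => Real.exp (-(f y - f xs)) * ‖φ y‖ ^ 4) :
    ∃ C₃ > 0, ∃ αt > (1 : ℝ), ∀ α > αt,
      ‖piInt f α φ‖ ^ 4 ≤ C₃ * mconst f xs α := by
  have hmin' : ∀ x, f xs ≤ f x := fun x => by
    by_cases h : x = xs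
    · rw [h]
    · exact (hmin x h).le
  obtain ⟨K, hK, r, hr, hb⟩ := quad_bound f xs hf hmin'
  have hdet : 0 < (hess f xs).det := hpd.det_pos
  set I : ℝ := ∫ y, Real.exp (-(f y - f xs)) * ‖φ y‖ ^ 4 with hI
  have hI0 : 0 ≤ I := integral_nonneg fun y => by positivity
  set v : ℝ := volume.real (Metric.ball (0 : E d) 1) with hv
  have hv0 : 0 < v := ENNReal.toReal_pos (Metric.measure_ball_pos _ _ one_pos).ne'
    measure_ball_lt_top.ne
  set D : ℝ := Real.sqrt (hess f xs).det * (1 / (2 * π)) ^ ((d : ℝ) / 2) with hD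
  have hD0 : 0 < D := by positivity
  refine ⟨(I + 1) / (Real.exp (-K) * v * D), by positivity, max 2 (1 / r ^ 2),
    lt_of_lt_of_le one_lt_two (le_max_left _ _), fun α hα => ?_⟩
  have hα2 : 2 < α := lt_of_le_of_lt (le_max_left _ _) hα
  have hαr : 1 / r ^ 2 < α := lt_of_le_of_lt (le_max_right _ _) hα
  have hα0 : 0 < α := by linarith
  set s : ℝ := (Real.sqrt α)⁻¹ with hs
  have hsq : Real.sqrt α ^ 2 = α := Real.sq_sqrt hα0.le
  have hsp : 0 < Real.sqrt α := Real.sqrt_pos.2 hα0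
  have hs0 : 0 < s := by positivity
  have hsα : α * s ^ 2 = 1 := by
    rw [hs, inv_pow, hsq]; field_simp
  have hsr : s < r := by
    have : 1 < α * r ^ 2 := by
      rw [div_lt_iff₀ (by positivity)] at hαr; exact hαr
    have h2 : s ^ 2 < r ^ 2 := by
      rw [← hsα] at this
      exact lt_of_mul_lt_mul_left this hα0.le
    exact lt_of_pow_lt_pow_left₀ 2 hr.le h2
  have hle : ∀ x, Real.exp (-(α * (f x - f xs))) ≤ Real.exp (-(f x - f xs)) := fun x => by
    apply Real.exp_le_exp.2
    nlinarith [hmin' x]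
  have hcont : Continuous fun x => Real.exp (-(α * (f x - f xs))) := by
    have := hf.continuous
    fun_prop
  have hg1 : Integrable fun x => Real.exp (-(f x - f xs)) := by
    refine (hfint.mul_const (Real.exp (f xs))).congr (Filter.Eventually.of_forall fun x => ?_)
    simp only [← Real.exp_add]
    congr 1; ring
  have hgα : Integrable fun x => Real.exp (-(α * (f x - f xs))) :=
    hg1.mono' hcont.aestronglyMeasurable (Filter.Eventually.of_forall fun x => by
      rw [Real.norm_of_nonneg (Real.exp_pos _).le]; exact hle x)
  have hZ := Z_lower f xs K r hK hb α s hα0 hs0 hsr hsα hgα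
  set Z : ℝ := ∫ x, Real.exp (-(α * (f x - f xs))) with hZdef
  rw [← hv] at hZ
  have hL0 : 0 < Real.exp (-K) * (s ^ d * v) := by positivity
  have hZ0 : 0 < Z := lt_of_lt_of_le hL0 hZ
  have hsplit : ∀ x, Real.exp (-α * f x) =
      Real.exp (-(α * (f x - f xs))) * Real.exp (-α * f xs) := fun x => by
    rw [← Real.exp_add]; congr 1; ring
  have hZc : Zc f α = Z * Real.exp (-α * f xs) := by
    rw [Zc, hZdef, ← integral_mul_const]
    exact integral_congr_ae (Filter.Eventually.of_forall hsplit)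
  have hpi : piInt f α φ = ∫ x, (Real.exp (-(α * (f x - f xs))) / Z) • φ x := by
    rw [piInt]
    refine integral_congr_ae (Filter.Eventually.of_forall fun x => ?_)
    simp only
    rw [hZc, hsplit x, mul_div_mul_right _ _ (Real.exp_pos _).ne']
  have h4 : Integrable fun x => Real.exp (-(α * (f x - f xs))) * ‖φ x‖ ^ 4 := by
    refine hφ4exp.mono' (hcont.aestronglyMeasurable.mul
      (hφmeas.norm.pow_const 4).aestronglyMeasurable) (Filter.Eventually.of_forall fun x => ?_)
    rw [Real.norm_of_nonneg (by positivity)]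
    exact mul_le_mul_of_nonneg_right (hle x) (by positivity)
  have h4le : ∫ x, Real.exp (-(α * (f x - f xs))) * ‖φ x‖ ^ 4 ≤ I :=
    integral_mono h4 hφ4exp fun x => mul_le_mul_of_nonneg_right (hle x) (by positivity)
  have heq : ∀ x, Real.exp (-(α * (f x - f xs))) / Z * ‖φ x‖ ^ 4 =
      (Real.exp (-(α * (f x - f xs))) * ‖φ x‖ ^ 4) / Z := fun x => by ring
  have hJ := jensen4 (fun x => Real.exp (-(α * (f x - f xs))) / Z) (fun x => by positivity)
    (hgα.div_const Z) (by rw [integral_div, ← hZdef, div_self hZ0.ne']) φ hφmeas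
    (by simp only [heq]; exact h4.div_const Z)
  simp only [heq] at hJ
  rw [integral_div, ← hpi] at hJ
  have hm : mconst f xs α = D * α ^ ((d : ℝ) / 2) := by
    rw [mconst, hD, div_eq_mul_one_div, Real.mul_rpow hα0.le (by positivity)]; ring
  have hαd : α ^ ((d : ℝ) / 2) = (s ^ d)⁻¹ := by
    rw [hs, inv_pow, inv_inv, Real.sqrt_eq_rpow, ← Real.rpow_natCast, ← Real.rpow_mul hα0.le]
    congr 1; ring
  calc ‖piInt f α φ‖ ^ 4 ≤ _ := hJ
    _ ≤ (I + 1) / (Real.exp (-K) * (s ^ d * v)) := by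
        apply div_le_div₀ (by positivity) (by linarith) hL0 hZ
    _ = _ := by
        rw [hm, hαd]; field_simp
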